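/- arXiv:2107.06226 — 2 statements merged into one kernel-verified Lean document; each statement's English description precedes it below -/
import Mathlib

section
/- PAC bound for CPPO in tabular MDPs: there exist universal constants c₁, c₂, c₃, c₄ such that in a tabular MDP (finite S and A), running CPPO with the empirical-distribution MLE and threshold ξ = c₁ |S|²|A| ln(n|S||A|c₂/δ)/n yields, for any comparator policy π* ∈ Π with density-ratio coefficient C_{π*,P*} < ∞, with probability at least 1 − δ, V^{π*}_{P*} − V^{π̂}_{P*} ≤ c₃ H² √( C_{π*,P*} |S|²|A| ln(n|S||A|c₄/δ) / n ). -/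
open Finset
open scoped BigOperators Classical

noncomputable section

namespace RL

/-- A transition model: a (candidate) conditional distribution over next states. -/
abbrev Trans (S A : Type) : Type := S → A → S → ℝ

/-- A (Markovian, stochastic) policy. -/
abbrev Pol (S A : Type) : Type := S → A → ℝ

/-- `p` is a probability distribution on a finite type. -/
def IsDist {X : Type} [Fintype X] (p : X → ℝ) : Prop :=
  (∀ x, 0 ≤ p x) ∧ ∑ x, p x = 1

def IsTrans {S A : Type} [Fintype S] (P : Trans S A) : Prop :=
  ∀ s a, IsDist (P s a)

def IsPol {S A : Type} [Fintype A] (π : Pol S A) : Prop :=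
  ∀ s, IsDist (π s)

variable {S A : Type} [Fintype S] [Fintype A]

/-- Value function with `h` steps to go. -/
def vAux (P : Trans S A) (π : Pol S A) (r : S → A → ℝ) : ℕ → S → ℝ
  | 0 => fun _ => 0
  | (h + 1) => fun s => ∑ a, π s a * (r s a + ∑ s', P s a s' * vAux P π r h s')

/-- `V^π_P`: expected cumulative reward over `H` steps from initial distribution `d0`. -/
def V (P : Trans S A) (π : Pol S A) (r : S → A → ℝ) (d0 : S → ℝ) (H : ℕ) : ℝ :=
  ∑ s, d0 s * vAux P π r H s

/-- State distribution at step `t` under policy `π` and transition `P`. -/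
def sDist (P : Trans S A) (π : Pol S A) (d0 : S → ℝ) : ℕ → S → ℝ
  | 0 => d0
  | (t + 1) => fun s' => ∑ s, ∑ a, sDist P π d0 t s * π s a * P s a s'

/-- `d^π_P`: average state-action occupancy distribution over horizon `H`. -/
def occ (P : Trans S A) (π : Pol S A) (d0 : S → ℝ) (H : ℕ) (s : S) (a : A) : ℝ :=
  (1 / (H : ℝ)) * ∑ t ∈ Finset.range H, sDist P π d0 t s * π s a

/-- ℓ₁ distance between two (signed) distributions on a finite type. -/
def l1 {X : Type} [Fintype X] (p q : X → ℝ) : ℝ := ∑ x, |p x - q x|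

/-- Expectation of `f` under a distribution on `S × A` given in curried form. -/
def expSA (μ : S → A → ℝ) (f : S → A → ℝ) : ℝ := ∑ s, ∑ a, μ s a * f s a

/-- An offline dataset of `n` tuples `(s, a, s')`. -/
abbrev Data (S A : Type) (n : ℕ) : Type := Fin n → S × A × S

/-- Empirical average `E_D[f(s,a,s')]`. -/
def emp {n : ℕ} (D : Data S A n) (f : S → A → S → ℝ) : ℝ :=
  (1 / (n : ℝ)) * ∑ i, f (D i).1 (D i).2.1 (D i).2.2

/-- Likelihood of the dataset `D` when `(s,a) ∼ ρ` i.i.d. and `s' ∼ P(·|s,a)`. -/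
def dataLik (ρ : S → A → ℝ) (P : Trans S A) {n : ℕ} (D : Data S A n) : ℝ :=
  ∏ i, ρ (D i).1 (D i).2.1 * P (D i).1 (D i).2.1 (D i).2.2

/-- Probability of the event `E` over the random draw of the offline dataset. -/
def dataProb (ρ : S → A → ℝ) (P : Trans S A) (n : ℕ) (E : Data S A n → Prop) : ℝ :=
  ∑ D : Data S A n, if E D then dataLik ρ P D else 0

/-- `Phat` is a maximum-likelihood estimator over the class `M` on the dataset `D`. -/
def IsMLE (M : Set (Trans S A)) {n : ℕ} (D : Data S A n) (Phat : Trans S A) : Prop :=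
  Phat ∈ M ∧
    ∀ P ∈ M, emp D (fun s a s' => Real.log (P s a s'))
      ≤ emp D (fun s a s' => Real.log (Phat s a s'))

/-- Membership in the version space `M_D` with threshold `ξ`. -/
def inVS (M : Set (Trans S A)) {n : ℕ} (D : Data S A n) (Phat : Trans S A) (ξ : ℝ)
    (P : Trans S A) : Prop :=
  P ∈ M ∧ emp D (fun s a _ => (l1 (P s a) (Phat s a)) ^ 2) ≤ ξ

/-- Pessimistic policy evaluation: `min_{P ∈ M_D} V^π_P`. -/
def pess (M : Set (Trans S A)) {n : ℕ} (D : Data S A n) (Phat : Trans S A) (ξ : ℝ)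
    (r : S → A → ℝ) (d0 : S → ℝ) (H : ℕ) (π : Pol S A) : ℝ :=
  sInf {v | ∃ P, inVS M D Phat ξ P ∧ v = V P π r d0 H}

/-- `πhat` is an output of CPPO: a maximizer over all policies of the pessimistic value. -/
def IsCPPO (M : Set (Trans S A)) {n : ℕ} (D : Data S A n) (Phat : Trans S A) (ξ : ℝ)
    (r : S → A → ℝ) (d0 : S → ℝ) (H : ℕ) (πhat : Pol S A) : Prop :=
  IsPol πhat ∧ ∀ π, IsPol π → pess M D Phat ξ r d0 H π ≤ pess M D Phat ξ r d0 H πhat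

end RL

open RL

namespace RL

variable {S A : Type} [Fintype S] [Fintype A]

/-- Number of visits of the state-action pair `(s,a)` in the dataset. -/
def visitCount {n : ℕ} (D : Data S A n) (s : S) (a : A) : ℕ :=
  (Finset.univ.filter fun i => (D i).1 = s ∧ (D i).2.1 = a).card

/-- Number of occurrences of the transition `(s,a,s')` in the dataset. -/
def tripleCount {n : ℕ} (D : Data S A n) (s : S) (a : A) (s' : S) : ℕ :=
  (Finset.univ.filter fun i => D i = (s, a, s')).card

/-- The tabular MLE: the empirical conditional distribution of `s'` given `(s,a)`. -/
def empMLE {n : ℕ} (D : Data S A n) : Trans S A :=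
  fun s a s' => (tripleCount D s a s' : ℝ) / (visitCount D s a : ℝ)

end RL

namespace RL

set_option linter.unusedSectionVars false

variable {S A : Type} [Fintype S] [Fintype A]

lemma l1_nonneg {X : Type} [Fintype X] (p q : X → ℝ) : 0 ≤ l1 p q :=
  Finset.sum_nonneg fun _ _ => abs_nonneg _

lemma l1_comm {X : Type} [Fintype X] (p q : X → ℝ) : l1 p q = l1 q p :=
  Finset.sum_congr rfl fun _ _ => abs_sub_comm _ _

lemma l1_triangle {X : Type} [Fintype X] (p q w : X → ℝ) : l1 p w ≤ l1 p q + l1 q w := by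
  unfold l1
  rw [← Finset.sum_add_distrib]
  exact Finset.sum_le_sum fun x _ => abs_sub_le _ _ _

lemma l1_le_two {X : Type} [Fintype X] {p q : X → ℝ} (hp : IsDist p) (hq : IsDist q) :
    l1 p q ≤ 2 := by
  have : l1 p q ≤ ∑ x, (p x + q x) := by
    refine Finset.sum_le_sum fun x _ => ?_
    have h1 := hp.1 x
    have h2 := hq.1 x
    rw [abs_le]
    constructor <;> linarith
  rw [Finset.sum_add_distrib, hp.2, hq.2] at this
  linarith

/-! ### Value functions and the simulation lemma -/

lemma vAux_mem {P : Trans S A} {π : Pol S A} {r : S → A → ℝ} (hP : IsTrans P) (hπ : IsPol π)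
    (hr : ∀ s a, 0 ≤ r s a ∧ r s a ≤ 1) (h : ℕ) (s : S) :
    0 ≤ vAux P π r h s ∧ vAux P π r h s ≤ h := by
  induction h generalizing s with
  | zero => simp [vAux]
  | succ h ih =>
    simp only [vAux]
    constructor
    · refine Finset.sum_nonneg fun a _ => mul_nonneg ((hπ s).1 a) (add_nonneg (hr s a).1 ?_)
      exact Finset.sum_nonneg fun s' _ => mul_nonneg ((hP s a).1 s') (ih s').1
    · have key : ∀ a, π s a * (r s a + ∑ s', P s a s' * vAux P π r h s') ≤
          π s a * ((h : ℝ) + 1) := fun a => by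
        refine mul_le_mul_of_nonneg_left ?_ ((hπ s).1 a)
        have : ∑ s', P s a s' * vAux P π r h s' ≤ ∑ s', P s a s' * (h : ℝ) :=
          Finset.sum_le_sum fun s' _ => mul_le_mul_of_nonneg_left (ih s').2 ((hP s a).1 s')
        rw [← Finset.sum_mul, (hP s a).2] at this
        linarith [(hr s a).2]
      refine (Finset.sum_le_sum fun a _ => key a).trans ?_
      rw [← Finset.sum_mul, (hπ s).2]
      push_cast
      linarith

lemma V_nonneg {P : Trans S A} {π : Pol S A} {r : S → A → ℝ} {d0 : S → ℝ} (hP : IsTrans P)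
    (hπ : IsPol π) (hr : ∀ s a, 0 ≤ r s a ∧ r s a ≤ 1) (hd : IsDist d0) (H : ℕ) :
    0 ≤ V P π r d0 H :=
  Finset.sum_nonneg fun s _ => mul_nonneg (hd.1 s) (vAux_mem hP hπ hr H s).1

lemma sDist_isDist {P : Trans S A} {π : Pol S A} {d0 : S → ℝ} (hP : IsTrans P) (hπ : IsPol π)
    (hd : IsDist d0) (t : ℕ) : IsDist (sDist P π d0 t) := by
  induction t with
  | zero => exact hd
  | succ t ih =>
    constructor
    · intro s'
      exact Finset.sum_nonneg fun s _ => Finset.sum_nonneg fun a _ =>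
        mul_nonneg (mul_nonneg (ih.1 s) ((hπ s).1 a)) ((hP s a).1 s')
    · simp only [sDist]
      rw [Finset.sum_comm]
      rw [← ih.2]
      refine Finset.sum_congr rfl fun s _ => ?_
      rw [Finset.sum_comm]
      simp only [← Finset.mul_sum, (hP _ _).2, mul_one, (hπ _).2]

lemma sDist_succ_start (P : Trans S A) (π : Pol S A) (d0 : S → ℝ) (t : ℕ) :
    sDist P π d0 (t + 1) = sDist P π (sDist P π d0 1) t := by
  induction t with
  | zero => rfl
  | succ t ih =>
    rw [sDist, ih]
    rfl

lemma sum_sub_mul_le_l1 {X : Type} [Fintype X] (p q v : X → ℝ) {b : ℝ}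
    (hv : ∀ x, 0 ≤ v x ∧ v x ≤ b) : ∑ x, (p x - q x) * v x ≤ l1 p q * b := by
  unfold l1
  rw [Finset.sum_mul]
  refine Finset.sum_le_sum fun x _ => ?_
  calc (p x - q x) * v x ≤ |p x - q x| * v x :=
        mul_le_mul_of_nonneg_right (le_abs_self _) (hv x).1
    _ ≤ _ := mul_le_mul_of_nonneg_left (hv x).2 (abs_nonneg _)

lemma simulation_step {P Q : Trans S A} {π : Pol S A} {r : S → A → ℝ} {B : ℝ}
    (hP : IsTrans P) (hQ : IsTrans Q) (hπ : IsPol π) (hr : ∀ s a, 0 ≤ r s a ∧ r s a ≤ 1)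
    (h : ℕ) (hB : (h : ℝ) ≤ B) {d0 : S → ℝ} (hd : IsDist d0) :
    ∑ s, d0 s * (vAux Q π r h s - vAux P π r h s) ≤
      B * ∑ t ∈ Finset.range h, ∑ s, ∑ a, sDist Q π d0 t s * π s a * l1 (Q s a) (P s a) := by
  induction h generalizing d0 with
  | zero => simp [vAux]
  | succ h ih =>
    have hB' : (h : ℝ) ≤ B := by push_cast at hB; linarith
    have ih' := ih hB' (sDist_isDist hQ hπ hd 1)
    simp only [← sDist_succ_start Q π d0] at ih'
    rw [Finset.sum_range_succ', mul_add]
    have e : ∑ s, d0 s * (vAux Q π r (h + 1) s - vAux P π r (h + 1) s) =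
        ∑ s', sDist Q π d0 1 s' * (vAux Q π r h s' - vAux P π r h s') +
        ∑ s, ∑ a, d0 s * π s a * ∑ s', (Q s a s' - P s a s') * vAux P π r h s' := by
      simp only [sDist, vAux, Finset.sum_mul]
      rw [Finset.sum_comm, ← Finset.sum_add_distrib]
      refine Finset.sum_congr rfl fun s _ => ?_
      rw [Finset.sum_comm, ← Finset.sum_add_distrib, ← Finset.sum_sub_distrib, Finset.mul_sum]
      refine Finset.sum_congr rfl fun a _ => ?_
      rw [Finset.mul_sum, ← Finset.sum_add_distrib, ← mul_sub, add_sub_add_left_eq_sub,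
        ← Finset.sum_sub_distrib, Finset.mul_sum, Finset.mul_sum]
      refine Finset.sum_congr rfl fun s' _ => ?_
      ring
    rw [e]
    refine add_le_add ih' ?_
    rw [Finset.mul_sum]
    refine Finset.sum_le_sum fun s _ => ?_
    rw [Finset.mul_sum]
    refine Finset.sum_le_sum fun a _ => ?_
    have := sum_sub_mul_le_l1 (Q s a) (P s a) (vAux P π r h) (b := B) fun x =>
      ⟨(vAux_mem hP hπ hr h x).1, (vAux_mem hP hπ hr h x).2.trans hB'⟩
    have h2 := mul_le_mul_of_nonneg_left this (mul_nonneg (hd.1 s) ((hπ s).1 a))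
    simp only [sDist]
    linarith

lemma occ_nonneg {P : Trans S A} {π : Pol S A} {d0 : S → ℝ} (hP : IsTrans P) (hπ : IsPol π)
    (hd : IsDist d0) (H : ℕ) (s : S) (a : A) : 0 ≤ occ P π d0 H s a :=
  mul_nonneg (by positivity) (Finset.sum_nonneg fun t _ =>
    mul_nonneg ((sDist_isDist hP hπ hd t).1 s) ((hπ s).1 a))

lemma expSA_occ (P : Trans S A) (π : Pol S A) (d0 : S → ℝ) (H : ℕ) (f : S → A → ℝ) :
    H * expSA (occ P π d0 H) f =
      ∑ t ∈ Finset.range H, ∑ s, ∑ a, sDist P π d0 t s * π s a * f s a := by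
  rcases Nat.eq_zero_or_pos H with rfl | hH
  · simp
  have hH' : (H : ℝ) ≠ 0 := by positivity
  unfold expSA occ
  rw [Finset.sum_comm (s := Finset.range H), Finset.mul_sum]
  refine Finset.sum_congr rfl fun s _ => ?_
  rw [Finset.sum_comm (s := Finset.range H), Finset.mul_sum]
  refine Finset.sum_congr rfl fun a _ => ?_
  rw [← mul_assoc, ← mul_assoc, mul_one_div_cancel hH', one_mul, Finset.sum_mul]

lemma sum_occ_le_one {P : Trans S A} {π : Pol S A} {d0 : S → ℝ} (hP : IsTrans P) (hπ : IsPol π)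
    (hd : IsDist d0) (H : ℕ) : ∑ s, ∑ a, occ P π d0 H s a ≤ 1 := by
  rcases Nat.eq_zero_or_pos H with rfl | hH
  · simp [occ]
  have hH' : (0 : ℝ) < H := by positivity
  have := expSA_occ P π d0 H (fun _ _ => 1)
  simp only [expSA, mul_one, ← Finset.mul_sum, (hπ _).2, (sDist_isDist hP hπ hd _).2,
    Finset.sum_const, Finset.card_range, nsmul_eq_mul] at this
  nlinarith

/-- Jensen's inequality for a sub-probability weight. -/
lemma expSA_le_sqrt {μ : S → A → ℝ} (hμ : ∀ s a, 0 ≤ μ s a) (hμ1 : ∑ s, ∑ a, μ s a ≤ 1)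
    (f : S → A → ℝ) : expSA μ f ≤ Real.sqrt (expSA μ fun s a => f s a ^ 2) := by
  apply Real.le_sqrt_of_sq_le
  have cs := Finset.sum_mul_sq_le_sq_mul_sq (Finset.univ : Finset (S × A))
    (fun x => Real.sqrt (μ x.1 x.2)) (fun x => Real.sqrt (μ x.1 x.2) * f x.1 x.2)
  simp only [← mul_assoc, mul_pow, Real.mul_self_sqrt (hμ _ _), Real.sq_sqrt (hμ _ _),
    Fintype.sum_prod_type] at cs
  refine cs.trans ?_
  refine mul_le_of_le_one_left ?_ hμ1
  exact Finset.sum_nonneg fun s _ => Finset.sum_nonneg fun a _ =>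
    mul_nonneg (hμ s a) (sq_nonneg _)

lemma V_sub_le {P Q : Trans S A} {π : Pol S A} {r : S → A → ℝ} {d0 : S → ℝ}
    (hP : IsTrans P) (hQ : IsTrans Q) (hπ : IsPol π) (hr : ∀ s a, 0 ≤ r s a ∧ r s a ≤ 1)
    (hd : IsDist d0) (H : ℕ) {ρ : S → A → ℝ} {C : ℝ}
    (hC : ∀ s a, occ Q π d0 H s a ≤ C * ρ s a) :
    V Q π r d0 H - V P π r d0 H ≤
      (H : ℝ) ^ 2 * Real.sqrt (C * expSA ρ fun s a => l1 (Q s a) (P s a) ^ 2) := by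
  have h1 := simulation_step hP hQ hπ hr H le_rfl hd
  rw [← expSA_occ Q π d0 H (fun s a => l1 (Q s a) (P s a))] at h1
  have h2 := expSA_le_sqrt (occ_nonneg hQ hπ hd H) (sum_occ_le_one hQ hπ hd H)
    (fun s a => l1 (Q s a) (P s a))
  have h3 : (expSA (occ Q π d0 H) fun s a => l1 (Q s a) (P s a) ^ 2) ≤
      C * expSA ρ fun s a => l1 (Q s a) (P s a) ^ 2 := by
    unfold expSA
    rw [Finset.mul_sum]
    refine Finset.sum_le_sum fun s _ => ?_
    rw [Finset.mul_sum]
    refine Finset.sum_le_sum fun a _ => ?_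
    rw [← mul_assoc]
    exact mul_le_mul_of_nonneg_right (hC s a) (sq_nonneg _)
  have h4 := h2.trans (Real.sqrt_le_sqrt h3)
  unfold V
  simp only [mul_sub, Finset.sum_sub_distrib] at h1
  refine h1.trans ?_
  rw [← mul_assoc, ← pow_two]
  exact mul_le_mul_of_nonneg_left h4 (by positivity)

/-! ### Concentration over the random dataset -/

lemma dataLik_nonneg {ρ : S → A → ℝ} {P : Trans S A} (hP : IsTrans P) (hρ : ∀ s a, 0 ≤ ρ s a)
    {n : ℕ} (D : Data S A n) : 0 ≤ dataLik ρ P D :=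
  Finset.prod_nonneg fun _ _ => mul_nonneg (hρ _ _) ((hP _ _).1 _)

lemma sum_dataLik_mul_prod (ρ : S → A → ℝ) (P : Trans S A) (n : ℕ) (g : S × A × S → ℝ) :
    ∑ D : Data S A n, dataLik ρ P D * ∏ i, g (D i) =
      (∑ s, ∑ a, ρ s a * ∑ s', P s a s' * g (s, a, s')) ^ n := by
  have h : ∑ s, ∑ a, ρ s a * ∑ s', P s a s' * g (s, a, s') =
      ∑ x : S × A × S, ρ x.1 x.2.1 * P x.1 x.2.1 x.2.2 * g x := by
    simp only [Fintype.sum_prod_type, Finset.mul_sum, mul_assoc]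
  rw [h, Fintype.sum_pow]
  refine Finset.sum_congr rfl fun D _ => ?_
  rw [dataLik, ← Finset.prod_mul_distrib]

lemma sum_dataLik {ρ : S → A → ℝ} {P : Trans S A} (hP : IsTrans P)
    (hρ : ∑ s, ∑ a, ρ s a = 1) (n : ℕ) : ∑ D : Data S A n, dataLik ρ P D = 1 := by
  have := sum_dataLik_mul_prod ρ P n (fun _ => 1)
  simpa [(hP _ _).2, hρ] using this

/-- Chernoff's bound. -/
lemma dataProb_le_exp {ρ : S → A → ℝ} {P : Trans S A} (hP : IsTrans P) (hρ : ∀ s a, 0 ≤ ρ s a)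
    {n : ℕ} {E : Data S A n → Prop} (g : S × A × S → ℝ) (L : ℝ)
    (hg : ∑ s, ∑ a, ρ s a * ∑ s', P s a s' * Real.exp (g (s, a, s')) ≤ 1)
    (hE : ∀ D, E D → L ≤ ∑ i, g (D i)) : dataProb ρ P n E ≤ Real.exp (-L) := by
  have h0 : 0 ≤ ∑ s, ∑ a, ρ s a * ∑ s', P s a s' * Real.exp (g (s, a, s')) :=
    Finset.sum_nonneg fun s _ => Finset.sum_nonneg fun a _ => mul_nonneg (hρ s a) <|
      Finset.sum_nonneg fun s' _ => mul_nonneg ((hP s a).1 s') (Real.exp_nonneg _)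
  have h1 := sum_dataLik_mul_prod ρ P n (fun x => Real.exp (g x))
  have h2 : dataProb ρ P n E ≤
      Real.exp (-L) * ∑ D : Data S A n, dataLik ρ P D * ∏ i, Real.exp (g (D i)) := by
    rw [Finset.mul_sum]
    refine Finset.sum_le_sum fun D _ => ?_
    have hD := dataLik_nonneg hP hρ D
    rw [← Real.exp_sum]
    split_ifs with h
    · rw [mul_left_comm, ← Real.exp_add]
      refine le_mul_of_one_le_right hD (Real.one_le_exp ?_)
      linarith [hE D h]
    · positivity
  rw [h1] at h2
  exact h2.trans (mul_le_of_le_one_right (Real.exp_nonneg _) (pow_le_one₀ h0 hg))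

lemma dataProb_ge_of_not {ρ : S → A → ℝ} {P : Trans S A} (hP : IsTrans P)
    (hρ : ∀ s a, 0 ≤ ρ s a) (hρ1 : ∑ s, ∑ a, ρ s a = 1) {n : ℕ} {ι : Type} [Fintype ι]
    {E : Data S A n → Prop} (B : ι → Data S A n → Prop) {ε : ℝ}
    (hB : ∀ i, dataProb ρ P n (B i) ≤ ε) (hE : ∀ D, (∀ i, ¬ B i D) → E D) :
    1 - Fintype.card ι * ε ≤ dataProb ρ P n E := by
  have h1 : ∑ i, dataProb ρ P n (B i) ≤ Fintype.card ι * ε := by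
    simpa using Finset.sum_le_card_nsmul Finset.univ _ ε fun i _ => hB i
  have h2 : 1 ≤ dataProb ρ P n E + ∑ i, dataProb ρ P n (B i) := by
    rw [← sum_dataLik hP hρ1 n]
    unfold dataProb
    rw [Finset.sum_comm, ← Finset.sum_add_distrib]
    refine Finset.sum_le_sum fun D _ => ?_
    have hD := dataLik_nonneg hP hρ D
    have hnn : ∀ i ∈ (Finset.univ : Finset ι), 0 ≤ if B i D then dataLik ρ P D else 0 :=
      fun i _ => by split_ifs <;> simp [hD]
    by_cases h : E D
    · rw [if_pos h]
      linarith [Finset.sum_nonneg hnn]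
    · obtain ⟨i, hi⟩ : ∃ i, B i D := by
        by_contra! hc
        exact h (hE D hc)
      have := Finset.single_le_sum hnn (Finset.mem_univ i)
      rw [if_pos hi] at this
      rw [if_neg h]
      linarith
  linarith

lemma sum_ite_pair (s : S) (a : A) (f : S → A → ℝ) :
    ∑ s', ∑ a', (if s' = s ∧ a' = a then f s' a' else 0) = f s a := by
  rw [Finset.sum_eq_single s, Finset.sum_eq_single a] <;> simp +contextual

lemma sum_eq_sum_visitCount {n : ℕ} (D : Data S A n) (f : S → A → ℝ) :
    ∑ i, f (D i).1 (D i).2.1 = ∑ s, ∑ a, (visitCount D s a : ℝ) * f s a := by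
  have : ∀ s a, (visitCount D s a : ℝ) * f s a =
      ∑ i, if s = (D i).1 ∧ a = (D i).2.1 then f s a else 0 := fun s a => by
    unfold visitCount
    rw [← Finset.sum_filter, Finset.sum_const, nsmul_eq_mul]
    simp only [eq_comm]
  simp only [this]
  rw [Finset.sum_congr rfl fun s _ => Finset.sum_comm, Finset.sum_comm]
  exact Finset.sum_congr rfl fun i _ => (sum_ite_pair _ _ f).symm

lemma visitCount_eq_sum {n : ℕ} (D : Data S A n) (s : S) (a : A) :
    (visitCount D s a : ℝ) = ∑ i, if (D i).1 = s ∧ (D i).2.1 = a then (1 : ℝ) else 0 := by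
  simp [visitCount]

/-- Lower tail bound for the number of visits. -/
lemma dataProb_visitCount_le {ρ : S → A → ℝ} {P : Trans S A} (hP : IsTrans P)
    (hρ : ∀ s a, 0 ≤ ρ s a) (hρ1 : ∑ s, ∑ a, ρ s a = 1) (n : ℕ) (s : S) (a : A) (L : ℝ) :
    dataProb ρ P n (fun D => L ≤ n * ρ s a / 2 - visitCount D s a) ≤ Real.exp (-L) := by
  refine dataProb_le_exp hP hρ
    (fun x => ρ s a / 2 - if x.1 = s ∧ x.2.1 = a then (1 : ℝ) else 0) L ?_ ?_
  · have e : ∀ s' a', ρ s' a' * ∑ s'', P s' a' s'' *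
        Real.exp (ρ s a / 2 - if s' = s ∧ a' = a then (1 : ℝ) else 0) =
        Real.exp (ρ s a / 2) * (ρ s' a' -
          if s' = s ∧ a' = a then ρ s' a' * (1 - Real.exp (-1)) else 0) := fun s' a' => by
      rw [← Finset.sum_mul, (hP s' a').2]
      split_ifs
      · rw [sub_eq_add_neg, Real.exp_add]
        ring
      · rw [sub_zero]
        ring
    simp only [e, ← Finset.mul_sum, Finset.sum_sub_distrib, hρ1]
    rw [sum_ite_pair s a (fun s' a' => ρ s' a' * (1 - Real.exp (-1)))]
    have he : Real.exp (-1) ≤ 1 / 2 := by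
      rw [Real.exp_neg, one_div]
      exact inv_anti₀ (by norm_num) (by linarith [Real.add_one_le_exp (1 : ℝ)])
    have h1 : 1 - ρ s a * (1 - Real.exp (-1)) ≤ Real.exp (-(ρ s a / 2)) := by
      have := Real.add_one_le_exp (-(ρ s a / 2))
      nlinarith [hρ s a]
    calc _ ≤ Real.exp (ρ s a / 2) * Real.exp (-(ρ s a / 2)) :=
          mul_le_mul_of_nonneg_left h1 (Real.exp_nonneg _)
      _ = 1 := by rw [← Real.exp_add]; simp
  · intro D hD
    rw [Finset.sum_sub_distrib, ← visitCount_eq_sum]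
    simp only [Finset.sum_const, Finset.card_univ, Fintype.card_fin, nsmul_eq_mul]
    linarith

/-- The sign associated with a Boolean. -/
def boolSign (b : Bool) : ℝ := if b then 1 else -1

lemma exp_mul_boolSign (t : ℝ) (b : Bool) :
    Real.exp (t * boolSign b) = Real.cosh t + boolSign b * Real.sinh t := by
  cases b
  · simp [boolSign, ← Real.cosh_sub_sinh, sub_eq_add_neg]
  · simp [boolSign, Real.cosh_add_sinh]

/-- A sub-Gaussian moment bound for random signs. -/
lemma sum_mul_exp_boolSign_le {p : S → ℝ} (hp : IsDist p) (σ : S → Bool) (t : ℝ) :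
    ∑ x, p x * Real.exp (t * (boolSign (σ x) - ∑ y, p y * boolSign (σ y)) - t ^ 2) ≤ 1 := by
  set m := ∑ y, p y * boolSign (σ y) with hm
  have h1 : ∀ u : ℝ, ∑ x, p x * Real.exp (u * boolSign (σ x)) =
      Real.cosh u + m * Real.sinh u := fun u => by
    simp only [exp_mul_boolSign, mul_add, Finset.sum_add_distrib, ← mul_assoc]
    rw [← Finset.sum_mul, ← Finset.sum_mul, hp.2, one_mul]
  have jensen : Real.exp (-t * m) ≤ Real.cosh t - m * Real.sinh t := by
    have := convexOn_exp.map_sum_le (t := Finset.univ) (w := p)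
      (p := fun x => -t * boolSign (σ x)) (fun x _ => hp.1 x) hp.2 (fun x _ => Set.mem_univ _)
    simp only [smul_eq_mul] at this
    rw [h1, Real.cosh_neg, Real.sinh_neg] at this
    have e : ∑ x, p x * (-t * boolSign (σ x)) = -t * m := by
      rw [hm, Finset.mul_sum]
      exact Finset.sum_congr rfl fun x _ => by ring
    rw [e] at this
    linarith
  have e : ∀ x, p x * Real.exp (t * (boolSign (σ x) - m) - t ^ 2) =
      p x * Real.exp (t * boolSign (σ x)) * (Real.exp (-t * m) * Real.exp (-t ^ 2)) := fun x => by
    rw [mul_assoc, ← Real.exp_add, ← Real.exp_add]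
    congr 2
    ring
  simp only [e]
  rw [← Finset.sum_mul, h1]
  have hpos : 0 ≤ Real.cosh t + m * Real.sinh t := by
    rw [← h1]
    exact Finset.sum_nonneg fun x _ => mul_nonneg (hp.1 x) (Real.exp_nonneg _)
  have h2 : (Real.cosh t + m * Real.sinh t) * Real.exp (-t * m) ≤ Real.exp (t ^ 2) := by
    calc _ ≤ (Real.cosh t + m * Real.sinh t) * (Real.cosh t - m * Real.sinh t) :=
          mul_le_mul_of_nonneg_left jensen hpos
      _ ≤ Real.cosh t ^ 2 := by nlinarith [sq_nonneg (m * Real.sinh t)]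
      _ ≤ Real.exp (t ^ 2 / 2) ^ 2 :=
          pow_le_pow_left₀ (Real.cosh_pos t).le (Real.cosh_le_exp_half_sq t) 2
      _ = Real.exp (t ^ 2) := by
          rw [← Real.exp_nat_mul]
          congr 1
          push_cast
          ring
  calc _ = ((Real.cosh t + m * Real.sinh t) * Real.exp (-t * m)) * Real.exp (-t ^ 2) := by ring
    _ ≤ Real.exp (t ^ 2) * Real.exp (-t ^ 2) :=
        mul_le_mul_of_nonneg_right h2 (Real.exp_nonneg _)
    _ = 1 := by rw [← Real.exp_add]; simp

/-- The centred sum of the signs of the next states observed after `(s, a)`. -/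
def signSum (P : Trans S A) {n : ℕ} (D : Data S A n) (s : S) (a : A) (σ : S → Bool) : ℝ :=
  ∑ i, if (D i).1 = s ∧ (D i).2.1 = a then
    boolSign (σ (D i).2.2) - ∑ y, P s a y * boolSign (σ y) else 0

lemma dataProb_signSum_le {ρ : S → A → ℝ} {P : Trans S A} (hP : IsTrans P)
    (hρ : ∀ s a, 0 ≤ ρ s a) (hρ1 : ∑ s, ∑ a, ρ s a = 1) (n : ℕ) (s : S) (a : A)
    (σ : S → Bool) (k : ℕ) {L : ℝ} (hL : 0 ≤ L) :
    dataProb ρ P n (fun D => visitCount D s a = k + 1 ∧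
      2 * Real.sqrt (L * (k + 1)) ≤ signSum P D s a σ) ≤ Real.exp (-L) := by
  have hk : (0 : ℝ) < k + 1 := by positivity
  set t := Real.sqrt (L / (k + 1)) with ht
  have ht0 : 0 ≤ t := Real.sqrt_nonneg _
  have ht2 : t ^ 2 * (k + 1) = L := by
    rw [ht, Real.sq_sqrt (by positivity)]
    field_simp
  have htL : t * Real.sqrt (L * (k + 1)) = L := by
    rw [ht, ← Real.sqrt_mul (by positivity), show L / (k + 1) * (L * (k + 1)) = L ^ 2 by field_simp,
      Real.sqrt_sq hL]
  refine dataProb_le_exp hP hρ (fun x => if x.1 = s ∧ x.2.1 = a then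
    t * (boolSign (σ x.2.2) - ∑ y, P s a y * boolSign (σ y)) - t ^ 2 else 0) L ?_ ?_
  · rw [← hρ1]
    refine Finset.sum_le_sum fun s' _ => Finset.sum_le_sum fun a' _ => ?_
    refine mul_le_of_le_one_right (hρ s' a') ?_
    by_cases h : s' = s ∧ a' = a
    · obtain ⟨rfl, rfl⟩ := h
      simpa using sum_mul_exp_boolSign_le (hP s' a') σ t
    · simp [h, (hP s' a').2]
  · rintro D ⟨hN, hM⟩
    have e : ∑ i, (if (D i).1 = s ∧ (D i).2.1 = a then
        t * (boolSign (σ (D i).2.2) - ∑ y, P s a y * boolSign (σ y)) - t ^ 2 else 0) =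
        t * signSum P D s a σ - t ^ 2 * visitCount D s a := by
      rw [visitCount_eq_sum, signSum, Finset.mul_sum, Finset.mul_sum, ← Finset.sum_sub_distrib]
      refine Finset.sum_congr rfl fun i _ => ?_
      split_ifs <;> simp
    rw [e, hN]
    push_cast
    have := mul_le_mul_of_nonneg_left hM ht0
    linarith

lemma signSum_eq (P : Trans S A) {n : ℕ} (D : Data S A n) (s : S) (a : A) (σ : S → Bool)
    (hN : visitCount D s a ≠ 0) :
    signSum P D s a σ =
      visitCount D s a * ∑ y, boolSign (σ y) * (empMLE D s a y - P s a y) := by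
  have hN' : (visitCount D s a : ℝ) ≠ 0 := by exact_mod_cast hN
  have h1 : ∑ i, (if (D i).1 = s ∧ (D i).2.1 = a then boolSign (σ (D i).2.2) else 0) =
      ∑ y, boolSign (σ y) * tripleCount D s a y := by
    have : ∀ y, boolSign (σ y) * tripleCount D s a y =
        ∑ i, if D i = (s, a, y) then boolSign (σ y) else 0 := fun y => by
      rw [← Finset.sum_filter, Finset.sum_const, nsmul_eq_mul, mul_comm]
      rfl
    simp only [this]
    rw [Finset.sum_comm]
    refine Finset.sum_congr rfl fun i _ => ?_
    obtain ⟨s₁, a₁, y₁⟩ := D i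
    by_cases h : s₁ = s ∧ a₁ = a
    · simp [h]
    · simp only [Prod.mk.injEq, ← and_assoc, h, false_and, if_false, Finset.sum_const_zero]
  have h2 : signSum P D s a σ = (∑ y, boolSign (σ y) * tripleCount D s a y) -
      visitCount D s a * ∑ y, P s a y * boolSign (σ y) := by
    rw [← h1, visitCount_eq_sum, signSum, Finset.sum_mul, ← Finset.sum_sub_distrib]
    refine Finset.sum_congr rfl fun i _ => ?_
    split_ifs <;> simp
  rw [h2, Finset.mul_sum, Finset.mul_sum, ← Finset.sum_sub_distrib]
  refine Finset.sum_congr rfl fun y _ => ?_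
  unfold empMLE
  field_simp

lemma visitCount_le {n : ℕ} (D : Data S A n) (s : S) (a : A) : visitCount D s a ≤ n :=
  (Finset.card_filter_le _ _).trans (by simp)

lemma visitCount_mul_l1_sq_le {P : Trans S A} {n : ℕ} {D : Data S A n} {s : S} {a : A} {L : ℝ}
    (hL : 0 ≤ L) (h : ∀ (σ : S → Bool) (k : Fin n), ¬ (visitCount D s a = (k : ℕ) + 1 ∧
      2 * Real.sqrt (L * ((k : ℕ) + 1)) ≤ signSum P D s a σ)) :
    (visitCount D s a : ℝ) * l1 (P s a) (empMLE D s a) ^ 2 ≤ 4 * L := by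
  rcases Nat.eq_zero_or_pos (visitCount D s a) with h0 | h0
  · rw [h0]
    simpa using hL
  obtain ⟨k, hk⟩ : ∃ k, visitCount D s a = k + 1 := ⟨_, (Nat.succ_pred_eq_of_pos h0).symm⟩
  have hkn : k < n := by have := visitCount_le D s a; omega
  have h1 := h (fun y => decide (P s a y ≤ empMLE D s a y)) ⟨k, hkn⟩
  rw [signSum_eq P D s a _ h0.ne'] at h1
  have e : ∑ y, boolSign (decide (P s a y ≤ empMLE D s a y)) * (empMLE D s a y - P s a y) =
      l1 (P s a) (empMLE D s a) := by
    refine Finset.sum_congr rfl fun y _ => ?_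
    by_cases hy : P s a y ≤ empMLE D s a y
    · rw [abs_of_nonpos (by linarith)]
      simp [boolSign, hy]
    · rw [abs_of_nonneg (by linarith)]
      simp [boolSign, hy]
  have h2 : (visitCount D s a : ℝ) * l1 (P s a) (empMLE D s a) <
      2 * Real.sqrt (L * visitCount D s a) := by
    by_contra! hc
    refine h1 ⟨hk, ?_⟩
    rw [e]
    rw [hk, Nat.cast_succ] at hc
    rwa [hk, Nat.cast_succ]
  have hN : (0 : ℝ) < visitCount D s a := by exact_mod_cast h0
  have h3 := pow_le_pow_left₀ (mul_nonneg hN.le (l1_nonneg _ _)) h2.le 2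
  rw [mul_pow, mul_pow, Real.sq_sqrt (by positivity)] at h3
  have h4 : (visitCount D s a : ℝ) * (visitCount D s a * l1 (P s a) (empMLE D s a) ^ 2) ≤
      visitCount D s a * (4 * L) := by nlinarith
  exact le_of_mul_le_mul_left h4 hN

/-! ### Deterministic analysis on the good event -/

lemma sum_sum_const (c : ℝ) :
    ∑ _s : S, ∑ _a : A, c = (Fintype.card S : ℝ) * Fintype.card A * c := by
  simp [mul_assoc]

lemma emp_l1_sq_le {P : Trans S A} {n : ℕ} {D : Data S A n} {L : ℝ}
    (h : ∀ s a, (visitCount D s a : ℝ) * l1 (P s a) (empMLE D s a) ^ 2 ≤ 4 * L) :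
    emp D (fun s a _ => l1 (P s a) (empMLE D s a) ^ 2) ≤
      1 / (n : ℝ) * ((Fintype.card S : ℝ) * Fintype.card A * (4 * L)) := by
  unfold emp
  refine mul_le_mul_of_nonneg_left ?_ (by positivity)
  rw [sum_eq_sum_visitCount D (fun s a => l1 (P s a) (empMLE D s a) ^ 2), ← sum_sum_const]
  exact Finset.sum_le_sum fun s _ => Finset.sum_le_sum fun a _ => h s a

lemma expSA_l1_sq_le {P Q : Trans S A} (hP : IsTrans P) (hQ : IsTrans Q) {ρ : S → A → ℝ} {n : ℕ}
    (hn : 0 < n) {D : Data S A n} {L ξ : ℝ} (hL : 0 ≤ L)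
    (hvis : ∀ s a, n * ρ s a / 2 - visitCount D s a ≤ L)
    (hPξ : emp D (fun s a _ => l1 (P s a) (empMLE D s a) ^ 2) ≤ ξ)
    (hQξ : emp D (fun s a _ => l1 (Q s a) (empMLE D s a) ^ 2) ≤ ξ) :
    (expSA ρ fun s a => l1 (Q s a) (P s a) ^ 2) ≤
      8 * ξ + 1 / (n : ℝ) * ((Fintype.card S : ℝ) * Fintype.card A * (8 * L)) := by
  have hn' : (0 : ℝ) < n := by exact_mod_cast hn
  have h1 : emp D (fun s a _ => l1 (Q s a) (P s a) ^ 2) ≤ 4 * ξ := by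
    have : emp D (fun s a _ => l1 (Q s a) (P s a) ^ 2) ≤
        2 * emp D (fun s a _ => l1 (Q s a) (empMLE D s a) ^ 2) +
        2 * emp D (fun s a _ => l1 (P s a) (empMLE D s a) ^ 2) := by
      unfold emp
      rw [mul_left_comm, mul_left_comm 2, ← mul_add]
      refine mul_le_mul_of_nonneg_left ?_ (by positivity)
      rw [Finset.mul_sum, Finset.mul_sum, ← Finset.sum_add_distrib]
      refine Finset.sum_le_sum fun i _ => ?_
      have ht := l1_triangle (Q (D i).1 (D i).2.1) (empMLE D (D i).1 (D i).2.1)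
        (P (D i).1 (D i).2.1)
      rw [l1_comm (empMLE D (D i).1 (D i).2.1)] at ht
      have hq := pow_le_pow_left₀ (l1_nonneg _ _) ht 2
      refine hq.trans ?_
      nlinarith [sq_nonneg (l1 (Q (D i).1 (D i).2.1) (empMLE D (D i).1 (D i).2.1) -
        l1 (P (D i).1 (D i).2.1) (empMLE D (D i).1 (D i).2.1))]
    linarith
  have h2 : (expSA ρ fun s a => l1 (Q s a) (P s a) ^ 2) ≤
      2 * emp D (fun s a _ => l1 (Q s a) (P s a) ^ 2) +
      1 / (n : ℝ) * ((Fintype.card S : ℝ) * Fintype.card A * (8 * L)) := by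
    unfold emp expSA
    rw [sum_eq_sum_visitCount D (fun s a => l1 (Q s a) (P s a) ^ 2), ← sum_sum_const,
      mul_left_comm, ← mul_add, one_div, ← div_eq_inv_mul, le_div_iff₀ hn', Finset.mul_sum,
      ← Finset.sum_add_distrib, Finset.sum_mul]
    refine Finset.sum_le_sum fun s _ => ?_
    rw [Finset.mul_sum, ← Finset.sum_add_distrib, Finset.sum_mul]
    refine Finset.sum_le_sum fun a _ => ?_
    have hx0 : 0 ≤ l1 (Q s a) (P s a) := l1_nonneg _ _
    have hx2 : l1 (Q s a) (P s a) ^ 2 ≤ 4 := by nlinarith [l1_le_two (hQ s a) (hP s a)]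
    have hv := mul_le_mul_of_nonneg_right (hvis s a) (sq_nonneg (l1 (Q s a) (P s a)))
    have hL4 := mul_le_mul_of_nonneg_left hx2 hL
    nlinarith
  linarith

/-- Pessimism: on the event that the true model lies in the version space, the suboptimality
of the CPPO policy is controlled by the value gap at the comparator policy. -/
lemma IsCPPO.V_sub_le {n : ℕ} {D : Data S A n} {Phat Pst : Trans S A} {ξ : ℝ} {r : S → A → ℝ}
    {d0 : S → ℝ} {H : ℕ} {πhat π : Pol S A} {b : ℝ}
    (h : IsCPPO {P : Trans S A | IsTrans P} D Phat ξ r d0 H πhat)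
    (hr : ∀ s a, 0 ≤ r s a ∧ r s a ≤ 1) (hd : IsDist d0) (hπ : IsPol π)
    (hst : inVS {P : Trans S A | IsTrans P} D Phat ξ Pst)
    (hb : ∀ P, inVS {P : Trans S A | IsTrans P} D Phat ξ P →
      V Pst π r d0 H - V P π r d0 H ≤ b) :
    V Pst π r d0 H - V Pst πhat r d0 H ≤ b := by
  have h1 : pess {P : Trans S A | IsTrans P} D Phat ξ r d0 H πhat ≤ V Pst πhat r d0 H := by
    refine csInf_le ⟨0, ?_⟩ ⟨Pst, hst, rfl⟩
    rintro _ ⟨P, hP, rfl⟩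
    exact V_nonneg hP.1 h.1 hr hd H
  have h2 : V Pst π r d0 H - b ≤ pess {P : Trans S A | IsTrans P} D Phat ξ r d0 H π := by
    refine le_csInf ⟨_, Pst, hst, rfl⟩ ?_
    rintro _ ⟨P, hP, rfl⟩
    linarith [hb P hP]
  linarith [h.2 π hπ]

end RL

/-- PAC bound for CPPO in tabular MDPs. -/
theorem cppo_pac_tabular :
    ∃ c₁ c₂ c₃ c₄ : ℝ, 0 < c₁ ∧ 0 < c₂ ∧ 0 < c₃ ∧ 0 < c₄ ∧
      ∀ (S A : Type) [Fintype S] [Fintype A]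
        (Pst : Trans S A) (ρ : S → A → ℝ)
        (r : S → A → ℝ) (d0 : S → ℝ) (H n : ℕ) (δ : ℝ) (πst : Pol S A) (C : ℝ),
        IsTrans Pst →
        IsDist (fun p : S × A => ρ p.1 p.2) →
        IsDist d0 →
        (∀ s a, 0 ≤ r s a ∧ r s a ≤ 1) →
        0 < n → 0 < δ → δ < 1 →
        IsPol πst →
        0 ≤ C →
        -- density-ratio partial coverage: `C` bounds `d^{π*}_{P*}(s,a)/ρ(s,a)`
        (∀ s a, occ Pst πst d0 H s a ≤ C * ρ s a) →
        1 - δ ≤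
          dataProb ρ Pst n (fun D =>
            ∀ πhat,
              IsCPPO {P : Trans S A | IsTrans P} D (empMLE D)
                (c₁ * ((Fintype.card S : ℝ) ^ 2 * (Fintype.card A : ℝ)) *
                  Real.log ((n : ℝ) * (Fintype.card S : ℝ) * (Fintype.card A : ℝ) * c₂ / δ)
                    / (n : ℝ))
                r d0 H πhat →
              V Pst πst r d0 H - V Pst πhat r d0 H
                ≤ c₃ * (H : ℝ) ^ 2 *
                    Real.sqrt (C * (Fintype.card S : ℝ) ^ 2 * (Fintype.card A : ℝ) *
                      Real.log ((n : ℝ) * (Fintype.card S : ℝ) * (Fintype.card A : ℝ) * c₄ / δ)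
                        / (n : ℝ))) := by
  refine ⟨8, 2, 9, 2, by norm_num, by norm_num, by norm_num, by norm_num, ?_⟩
  intro S A _ _ Pst ρ r d0 H n δ πst C hPst hρ hd hr hn hδ hδ1 hπ hC0 hC
  have hρ0 : ∀ s a, 0 ≤ ρ s a := fun s a => hρ.1 (s, a)
  have hρ1 : ∑ s, ∑ a, ρ s a = 1 := by
    rw [← hρ.2, Fintype.sum_prod_type]
  obtain ⟨⟨s₀, a₀⟩⟩ : Nonempty (S × A) := by
    by_contra hne
    rw [not_nonempty_iff] at hne
    simpa using hρ.2
  have hSpos : 0 < Fintype.card S := Fintype.card_pos_iff.2 ⟨s₀⟩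
  have hApos : 0 < Fintype.card A := Fintype.card_pos_iff.2 ⟨a₀⟩
  have hS1 : (1 : ℝ) ≤ Fintype.card S := by exact_mod_cast hSpos
  have hA1 : (1 : ℝ) ≤ Fintype.card A := by exact_mod_cast hApos
  have hn1 : (1 : ℝ) ≤ n := by exact_mod_cast hn
  have hn0 : (0 : ℝ) < n := by linarith
  set ℓ := Real.log ((n : ℝ) * (Fintype.card S : ℝ) * (Fintype.card A : ℝ) * 2 / δ) with hℓ
  have harg : 2 ≤ (n : ℝ) * (Fintype.card S : ℝ) * (Fintype.card A : ℝ) * 2 / δ := by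
    rw [le_div_iff₀ hδ]
    have : 1 ≤ (n : ℝ) * (Fintype.card S : ℝ) * (Fintype.card A : ℝ) :=
      one_le_mul_of_one_le_of_one_le (one_le_mul_of_one_le_of_one_le hn1 hS1) hA1
    nlinarith
  have hℓ2 : Real.log 2 ≤ ℓ := Real.log_le_log (by norm_num) harg
  have hlog2 : 0 < Real.log 2 := Real.log_pos (by norm_num)
  have hℓ0 : 0 ≤ ℓ := hlog2.le.trans hℓ2
  set L := (Fintype.card S : ℝ) * Real.log 2 + ℓ with hLdef
  have hL0 : 0 ≤ L := by positivity
  have hL2 : L ≤ 2 * Fintype.card S * ℓ := by nlinarith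
  have hexp : Real.exp (-L) = δ / (2 ^ Fintype.card S *
      ((n : ℝ) * (Fintype.card S : ℝ) * (Fintype.card A : ℝ) * 2)) := by
    rw [Real.exp_neg, hLdef, Real.exp_add, Real.exp_nat_mul, Real.exp_log (by norm_num), hℓ,
      Real.exp_log (by linarith)]
    field_simp
  let bad : (S × A) ⊕ (S × A) × (S → Bool) × Fin n → Data S A n → Prop := Sum.elim
    (fun p D => L ≤ n * ρ p.1 p.2 / 2 - visitCount D p.1 p.2)
    (fun p D => visitCount D p.1.1 p.1.2 = (p.2.2 : ℕ) + 1 ∧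
      2 * Real.sqrt (L * ((p.2.2 : ℕ) + 1)) ≤ signSum Pst D p.1.1 p.1.2 p.2.1)
  have hbad : ∀ i, dataProb ρ Pst n (bad i) ≤ Real.exp (-L) := by
    rintro (⟨s, a⟩ | ⟨⟨s, a⟩, σ, k⟩)
    · exact dataProb_visitCount_le hPst hρ0 hρ1 n s a L
    · exact dataProb_signSum_le hPst hρ0 hρ1 n s a σ k hL0
  refine le_trans ?_ (dataProb_ge_of_not hPst hρ0 hρ1 bad hbad ?_)
  · have hcard : (Fintype.card ((S × A) ⊕ (S × A) × (S → Bool) × Fin n) : ℝ) =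
        Fintype.card S * Fintype.card A * (1 + 2 ^ Fintype.card S * n) := by
      simp
      ring
    have h2S : (1 : ℝ) ≤ 2 ^ Fintype.card S := one_le_pow₀ (by norm_num)
    have h2n : (1 : ℝ) ≤ 2 ^ Fintype.card S * n := one_le_mul_of_one_le_of_one_le h2S hn1
    rw [hcard, hexp]
    refine sub_le_sub_left ?_ 1
    rw [mul_div_assoc', div_le_iff₀ (by positivity)]
    have hk : 0 ≤ (Fintype.card S : ℝ) * Fintype.card A * δ := by positivity
    nlinarith [mul_le_mul_of_nonneg_left h2n hk]
  · intro D hgood πhat hcppo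
    have hvis : ∀ s a, n * ρ s a / 2 - visitCount D s a ≤ L := fun s a =>
      (not_le.1 (hgood (Sum.inl (s, a)))).le
    have hl1 : ∀ s a, (visitCount D s a : ℝ) * l1 (Pst s a) (empMLE D s a) ^ 2 ≤ 4 * L :=
      fun s a => visitCount_mul_l1_sq_le hL0 fun σ k => hgood (Sum.inr ((s, a), σ, k))
    have hSA : (0 : ℝ) ≤ Fintype.card S * Fintype.card A := by positivity
    have hSAL : (Fintype.card S : ℝ) * Fintype.card A * L ≤
        2 * (Fintype.card S : ℝ) ^ 2 * Fintype.card A * ℓ := by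
      nlinarith [mul_le_mul_of_nonneg_left hL2 hSA]
    have hst : inVS {P : Trans S A | IsTrans P} D (empMLE D)
        (8 * ((Fintype.card S : ℝ) ^ 2 * (Fintype.card A : ℝ)) * ℓ / n) Pst := by
      refine ⟨hPst, (emp_l1_sq_le hl1).trans ?_⟩
      rw [one_div, ← div_eq_inv_mul]
      refine div_le_div_of_nonneg_right ?_ hn0.le
      linarith
    refine hcppo.V_sub_le hr hd hπ hst fun P hP => ?_
    refine (V_sub_le hP.1 hPst hπ hr hd H hC).trans ?_
    have hpop := expSA_l1_sq_le hP.1 hPst hn hL0 hvis hP.2 hst.2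
    have hpop' : (expSA ρ fun s a => l1 (Pst s a) (P s a) ^ 2) ≤
        81 * ((Fintype.card S : ℝ) ^ 2 * Fintype.card A * ℓ / n) := by
      refine hpop.trans ?_
      rw [one_div, ← div_eq_inv_mul, mul_div_assoc', mul_div_assoc', ← add_div]
      refine div_le_div_of_nonneg_right ?_ hn0.le
      have : 0 ≤ (Fintype.card S : ℝ) ^ 2 * Fintype.card A * ℓ := by positivity
      linarith
    have hsqrt : Real.sqrt (C * expSA ρ fun s a => l1 (Pst s a) (P s a) ^ 2) ≤
        9 * Real.sqrt (C * (Fintype.card S : ℝ) ^ 2 * Fintype.card A * ℓ / n) := by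
      rw [show (9 : ℝ) = Real.sqrt (9 ^ 2) from (Real.sqrt_sq (by norm_num)).symm,
        ← Real.sqrt_mul (by norm_num)]
      refine Real.sqrt_le_sqrt ((mul_le_mul_of_nonneg_left hpop' hC0).trans_eq ?_)
      ring
    calc _ ≤ (H : ℝ) ^ 2 *
          (9 * Real.sqrt (C * (Fintype.card S : ℝ) ^ 2 * Fintype.card A * ℓ / n)) :=
          mul_le_mul_of_nonneg_left hsqrt (by positivity)
      _ = _ := by ring
end
end

section
/- Simulation lemma: for any two transition models P and P̂ and any policy π : S → Δ(A) in a finite-horizon MDP, V^π_P − V^π_{P̂} = Σ_{h=0}^{H−1} E_{(s,a)∼d^π_P}[ E_{s'∼P(·|s,a)}[V^π_{P̂;h}(s')] − E_{s'∼P̂(·|s,a)}[V^π_{P̂;h}(s')] ] ≤ H² · E_{(s,a)∼d^π_P}[ ‖V^π_{P̂,h}‖_∞ · ‖P(·|s,a) − P̂(·|s,a)‖₁ ]; in particular, with rewards in [0,1], V^π_P − V^π_{P̂} ≤ H² E_{(s,a)∼d^π_P}[ ‖P(·|s,a) − P̂(·|s,a)‖₁ ]. -/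
open Finset
open scoped BigOperators Classical

noncomputable section

open RL

namespace RL

/-- Sup-norm over states and steps-to-go of the value functions of `π` under `Phat`. -/
def vSup {S A : Type} [Fintype S] [Fintype A] [Nonempty S]
    (Phat : Trans S A) (π : Pol S A) (r : S → A → ℝ) (H : ℕ) : ℝ :=
  Finset.univ.sup' Finset.univ_nonempty
    (fun p : Fin (H + 1) × S => |vAux Phat π r (p.1 : ℕ) p.2|)

end RL

namespace RL

variable {S A : Type} [Fintype S] [Fintype A]

/-- Replacing one step of `Phat` by one step of `P` after `t` steps of `P` costs the expected
model error at step `t`. -/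
lemma sum_sDist_succ_mul_vAux (P Phat : Trans S A) (π : Pol S A) (r : S → A → ℝ) (d0 : S → ℝ)
    (t n : ℕ) :
    (∑ s, sDist P π d0 (t + 1) s * vAux Phat π r n s) -
        (∑ s, sDist P π d0 t s * vAux Phat π r (n + 1) s) +
        ∑ s, ∑ a, sDist P π d0 t s * π s a * r s a =
      ∑ s, ∑ a, sDist P π d0 t s * π s a *
        ((∑ s', P s a s' * vAux Phat π r n s') - ∑ s', Phat s a s' * vAux Phat π r n s') := by
  have h : ∑ s', sDist P π d0 (t + 1) s' * vAux Phat π r n s' =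
      ∑ s, ∑ a, sDist P π d0 t s * π s a * ∑ s', P s a s' * vAux Phat π r n s' := by
    simp only [sDist, Finset.sum_mul, Finset.mul_sum]
    rw [Finset.sum_comm]
    refine Finset.sum_congr rfl fun s _ => ?_
    rw [Finset.sum_comm]
    exact Finset.sum_congr rfl fun a _ => Finset.sum_congr rfl fun s' _ => by ring
  rw [h, ← Finset.sum_sub_distrib, ← Finset.sum_add_distrib]
  refine Finset.sum_congr rfl fun s _ => ?_
  rw [vAux, Finset.mul_sum, ← Finset.sum_sub_distrib, ← Finset.sum_add_distrib]
  exact Finset.sum_congr rfl fun a _ => by ring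

lemma sum_reward_sub_V (P Phat : Trans S A) (π : Pol S A) (r : S → A → ℝ) (d0 : S → ℝ) (H : ℕ) :
    (∑ h ∈ Finset.range H, ∑ s, ∑ a, sDist P π d0 h s * π s a * r s a) - V Phat π r d0 H =
      ∑ h ∈ Finset.range H, ∑ s, ∑ a, sDist P π d0 h s * π s a *
        ((∑ s', P s a s' * vAux Phat π r (H - 1 - h) s') -
          ∑ s', Phat s a s' * vAux Phat π r (H - 1 - h) s') := by
  have tel := Finset.sum_range_sub
    (fun t => ∑ s, sDist P π d0 t s * vAux Phat π r (H - t) s) H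
  have h0 : ∑ s, sDist P π d0 H s * vAux Phat π r (H - H) s = 0 := by simp [vAux]
  have h1 : ∑ s, sDist P π d0 0 s * vAux Phat π r (H - 0) s = V Phat π r d0 H := rfl
  rw [h0, h1, zero_sub] at tel
  rw [sub_eq_add_neg, ← tel, ← Finset.sum_add_distrib]
  refine Finset.sum_congr rfl fun t ht => ?_
  have ht' := Finset.mem_range.1 ht
  rw [← sum_sDist_succ_mul_vAux, show H - (t + 1) = H - 1 - t by omega,
    show H - t = H - 1 - t + 1 by omega, add_comm]

/-- The value difference as a sum of expected one-step model errors. -/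
lemma V_sub_V (P Phat : Trans S A) (π : Pol S A) (r : S → A → ℝ) (d0 : S → ℝ) (H : ℕ) :
    V P π r d0 H - V Phat π r d0 H =
      ∑ h ∈ Finset.range H, ∑ s, ∑ a, sDist P π d0 h s * π s a *
        ((∑ s', P s a s' * vAux Phat π r (H - 1 - h) s') -
          ∑ s', Phat s a s' * vAux Phat π r (H - 1 - h) s') := by
  have h := sum_reward_sub_V P P π r d0 H
  simp only [sub_self, mul_zero, Finset.sum_const_zero] at h
  rw [← sum_reward_sub_V, sub_eq_zero.1 h]

lemma sDist_nonneg {P : Trans S A} {π : Pol S A} {d0 : S → ℝ} (hP : IsTrans P) (hπ : IsPol π)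
    (hd0 : IsDist d0) (t : ℕ) (s : S) : 0 ≤ sDist P π d0 t s := by
  induction t generalizing s with
  | zero => exact hd0.1 s
  | succ t ih =>
    exact Finset.sum_nonneg fun s' _ => Finset.sum_nonneg fun a _ =>
      mul_nonneg (mul_nonneg (ih s') ((hπ s').1 a)) ((hP s' a).1 s)

lemma IsDist.sum_mul_mem_Icc {X : Type} [Fintype X] {p f : X → ℝ} {b : ℝ} (hp : IsDist p)
    (hf : ∀ x, f x ∈ Set.Icc 0 b) : ∑ x, p x * f x ∈ Set.Icc 0 b := by
  refine ⟨Finset.sum_nonneg fun x _ => mul_nonneg (hp.1 x) (hf x).1, ?_⟩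
  calc ∑ x, p x * f x ≤ ∑ x, p x * b :=
        Finset.sum_le_sum fun x _ => mul_le_mul_of_nonneg_left (hf x).2 (hp.1 x)
    _ = b := by rw [← Finset.sum_mul, hp.2, one_mul]

lemma vAux_mem_Icc {P : Trans S A} {π : Pol S A} {r : S → A → ℝ} (hP : IsTrans P) (hπ : IsPol π)
    (hr : ∀ s a, 0 ≤ r s a ∧ r s a ≤ 1) (n : ℕ) (s : S) :
    vAux P π r n s ∈ Set.Icc (0 : ℝ) n := by
  induction n generalizing s with
  | zero => simp [vAux]
  | succ n ih =>
    refine (hπ s).sum_mul_mem_Icc fun a => ?_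
    have h := (hP s a).sum_mul_mem_Icc ih
    have h' := hr s a
    push_cast
    exact ⟨add_nonneg h'.1 h.1, by linarith [h.2, h'.2]⟩

lemma sum_mul_sub_sum_mul_le {X : Type} [Fintype X] (p q : X → ℝ) {v : X → ℝ} {C : ℝ}
    (hv : ∀ x, |v x| ≤ C) : (∑ x, p x * v x) - ∑ x, q x * v x ≤ C * l1 p q := by
  rw [l1, Finset.mul_sum, ← Finset.sum_sub_distrib]
  refine Finset.sum_le_sum fun x _ => ?_
  calc p x * v x - q x * v x = v x * (p x - q x) := by ring
    _ ≤ |v x| * |p x - q x| := (le_abs_self _).trans (abs_mul _ _).le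
    _ ≤ C * |p x - q x| := mul_le_mul_of_nonneg_right (hv x) (abs_nonneg _)

lemma mul_expSA_occ (P : Trans S A) (π : Pol S A) (d0 : S → ℝ) (H : ℕ) (f : S → A → ℝ) :
    (H : ℝ) * expSA (occ P π d0 H) f =
      ∑ h ∈ Finset.range H, ∑ s, ∑ a, sDist P π d0 h s * π s a * f s a := by
  rcases Nat.eq_zero_or_pos H with rfl | hH
  · simp
  have hH' : (H : ℝ) ≠ 0 := by positivity
  rw [expSA, Finset.mul_sum, Finset.sum_comm]
  refine Finset.sum_congr rfl fun s _ => ?_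
  rw [Finset.mul_sum, Finset.sum_comm]
  refine Finset.sum_congr rfl fun a _ => ?_
  rw [occ, ← mul_assoc, ← mul_assoc, mul_one_div_cancel hH', one_mul, Finset.sum_mul]

lemma V_sub_V_le {P Phat : Trans S A} {π : Pol S A} {r : S → A → ℝ} {d0 : S → ℝ} {H : ℕ}
    (hP : IsTrans P) (hπ : IsPol π) (hd0 : IsDist d0) {C : ℝ}
    (hC : ∀ n ≤ H, ∀ s, |vAux Phat π r n s| ≤ C) :
    V P π r d0 H - V Phat π r d0 H ≤
      (H : ℝ) * expSA (occ P π d0 H) (fun s a => C * l1 (P s a) (Phat s a)) := by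
  rw [V_sub_V, mul_expSA_occ]
  refine Finset.sum_le_sum fun h _ => Finset.sum_le_sum fun s _ => Finset.sum_le_sum fun a _ => ?_
  exact mul_le_mul_of_nonneg_left (sum_mul_sub_sum_mul_le _ _ (hC _ (by omega)))
    (mul_nonneg (sDist_nonneg hP hπ hd0 h s) ((hπ s).1 a))

lemma abs_vAux_le_vSup [Nonempty S] (Phat : Trans S A) (π : Pol S A) (r : S → A → ℝ) {n H : ℕ}
    (hn : n ≤ H) (s : S) : |vAux Phat π r n s| ≤ vSup Phat π r H :=
  Finset.le_sup' (fun p : Fin (H + 1) × S => |vAux Phat π r (p.1 : ℕ) p.2|)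
    (Finset.mem_univ (⟨n, Nat.lt_succ_of_le hn⟩, s))

end RL

/-- Simulation lemma. -/
theorem simulation_lemma
    (S A : Type) [Fintype S] [Fintype A] [Nonempty S]
    (P Phat : Trans S A) (π : Pol S A) (r : S → A → ℝ) (d0 : S → ℝ) (H : ℕ)
    (hP : IsTrans P) (hPhat : IsTrans Phat) (hπ : IsPol π) (hd0 : IsDist d0)
    (hr : ∀ s a, 0 ≤ r s a ∧ r s a ≤ 1) :
    -- exact telescoping identity, with `V^π_{P̂;h}` the value with `H-1-h` steps to go
    V P π r d0 H - V Phat π r d0 H =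
      (∑ h ∈ Finset.range H, ∑ s, ∑ a, sDist P π d0 h s * π s a *
        ((∑ s', P s a s' * vAux Phat π r (H - 1 - h) s') -
          ∑ s', Phat s a s' * vAux Phat π r (H - 1 - h) s')) ∧
    -- bound via the sup-norm of the value functions and the ℓ₁ model error
    V P π r d0 H - V Phat π r d0 H ≤
      (H : ℝ) ^ 2 * expSA (occ P π d0 H)
        (fun s a => vSup Phat π r H * l1 (P s a) (Phat s a)) ∧
    -- in particular, with rewards in [0,1]
    V P π r d0 H - V Phat π r d0 H ≤
      (H : ℝ) ^ 2 * expSA (occ P π d0 H) (fun s a => l1 (P s a) (Phat s a)) := by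
  refine ⟨V_sub_V P Phat π r d0 H, ?_, ?_⟩
  · refine (V_sub_V_le hP hπ hd0 fun n hn s => abs_vAux_le_vSup Phat π r hn s).trans ?_
    have hv : 0 ≤ vSup Phat π r H :=
      (abs_nonneg _).trans (abs_vAux_le_vSup Phat π r (Nat.zero_le H) (Classical.arbitrary S))
    have hE : 0 ≤ (H : ℝ) * expSA (occ P π d0 H)
        (fun s a => vSup Phat π r H * l1 (P s a) (Phat s a)) := by
      rw [mul_expSA_occ]
      exact Finset.sum_nonneg fun h _ => Finset.sum_nonneg fun s _ => Finset.sum_nonneg fun a _ =>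
        mul_nonneg (mul_nonneg (sDist_nonneg hP hπ hd0 h s) ((hπ s).1 a))
          (mul_nonneg hv (Finset.sum_nonneg fun x _ => abs_nonneg _))
    rcases Nat.eq_zero_or_pos H with rfl | hH
    · simp
    rw [pow_two, mul_assoc]
    exact le_mul_of_one_le_left hE (by exact_mod_cast hH)
  · have hC : ∀ n ≤ H, ∀ s, |vAux Phat π r n s| ≤ (H : ℝ) := fun n hn s => by
      have h := vAux_mem_Icc hPhat hπ hr n s
      rw [abs_of_nonneg h.1]
      exact h.2.trans (by exact_mod_cast hn)
    refine (V_sub_V_le hP hπ hd0 hC).trans_eq ?_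
    rw [pow_two, mul_assoc]
    congr 1
    simp only [expSA, Finset.mul_sum]
    exact Finset.sum_congr rfl fun s _ => Finset.sum_congr rfl fun a _ => by ring
end
end
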